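/- Let X ⊆ ℙᵐ × ℙⁿ be a closed subset, let ℓ_x ∈ ℂ[x₀, …, x_m] and ℓ_y ∈ ℂ[y₀, …, y_n] be homogeneous of degree 1, and let g₀ ∈ ℂ[u, x, v, y] be bihomogeneous of bidegree (d, e) with d, e ≥ 1. Set W_x := X ∩ V(ℓ_x) and W_y := X ∩ V(ℓ_y), and assume: (i) W_x and W_y are finite and X ∩ V(ℓ_x) ∩ V(ℓ_y) = ∅; (ii) g₀(1, 𝟎, 1, 𝟎) ≠ 0; (iii) the projection π_x is injective on W_x and π_y is injective on W_y; (iv) for each point ([x], [y]) ∈ W_x, with any nonzero representative x, the univariate polynomial u ↦ g₀(u, x, 1, 𝟎) has exactly d distinct complex roots, and for each point ([x], [y]) ∈ W_y, with any nonzero representative y, the univariate polynomial v ↦ g₀(1, 𝟎, v, y) has exactly e distinct complex roots. Then X̃ ∩ V(g₀, ℓ_x, ℓ_y) is a finite set of cardinality d · |W_x| + e · |W_y|. -/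

import Mathlib

open MvPolynomial

noncomputable section

namespace UGen

/-- The (quotient of the Euclidean) topology on the projectivization of `ℂ^N`. -/
instance {N : ℕ} : TopologicalSpace (Projectivization ℂ (Fin N → ℂ)) :=
  inferInstanceAs (TopologicalSpace (Quotient (projectivizationSetoid ℂ (Fin N → ℂ))))

lemma cons_ne_zero {N : ℕ} (u : ℂ) {x : Fin N → ℂ} (hx : x ≠ 0) :
    (Fin.cons u x : Fin (N + 1) → ℂ) ≠ 0 := by
  intro h
  apply hx
  funext i
  simpa using congrFun h i.succ

lemma one_zero_ne_zero {N : ℕ} : (Fin.cons 1 0 : Fin (N + 1) → ℂ) ≠ 0 := by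
  intro h
  simpa using congrFun h 0

/-- The distinguished point `[1 : 0 : ⋯ : 0]`. -/
def e0 {N : ℕ} : Projectivization ℂ (Fin (N + 1) → ℂ) :=
  Projectivization.mk ℂ (Fin.cons 1 0) one_zero_ne_zero

/-- The vanishing locus in `ℙ^{N-1}` of a polynomial in `N` variables (for homogeneous
polynomials vanishing does not depend on the representative; we require vanishing at
every representative). -/
def Vp {N : ℕ} (h : MvPolynomial (Fin N) ℂ) : Set (Projectivization ℂ (Fin N → ℂ)) :=
  { p | ∀ (w : Fin N → ℂ) (hw : w ≠ 0), p = Projectivization.mk ℂ w hw → eval w h = 0 }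

/-- The "open part" of the cone over `X ⊆ ℙⁿ`: all points `[u : x]` with `[x] ∈ X`. -/
def coneO {n : ℕ} (X : Set (Projectivization ℂ (Fin (n + 1) → ℂ))) :
    Set (Projectivization ℂ (Fin (n + 2) → ℂ)) :=
  { q | ∃ (u : ℂ) (x : Fin (n + 1) → ℂ) (hx : x ≠ 0),
      Projectivization.mk ℂ x hx ∈ X ∧
        q = Projectivization.mk ℂ (Fin.cons u x) (cons_ne_zero u hx) }

/-- The cone `X̃ ⊆ ℙ^{n+1}` over `X ⊆ ℙⁿ`. -/
def cone {n : ℕ} (X : Set (Projectivization ℂ (Fin (n + 1) → ℂ))) :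
    Set (Projectivization ℂ (Fin (n + 2) → ℂ)) :=
  coneO X ∪ {e0}

end UGen

namespace UGen

lemma cons_pair_ne_zero {N : ℕ} {a b : ℂ} (hab : (a, b) ≠ (0, 0)) {x : Fin N → ℂ}
    (hx : x ≠ 0) : (Fin.cons a (b • x) : Fin (N + 1) → ℂ) ≠ 0 := by
  rcases eq_or_ne b 0 with hb | hb
  · subst hb
    have ha : a ≠ 0 := by simpa using hab
    intro h
    exact ha (by simpa using congrFun h 0)
  · exact cons_ne_zero a (smul_ne_zero hb hx)

/-- Bihomogeneity of bidegree `(d, e)` in two groups of variables,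
phrased via weighted homogeneity with weights `(1,0)` and `(0,1)`. -/
def IsBihomogeneous {a b : ℕ} (g : MvPolynomial (Fin a ⊕ Fin b) ℂ) (d e : ℕ) : Prop :=
  g.IsWeightedHomogeneous
    (Sum.elim (fun _ => ((1 : ℕ), (0 : ℕ))) (fun _ => ((0 : ℕ), (1 : ℕ)))) (d, e)

/-- The vanishing locus, in a product of two projectivizations, of a polynomial in the two
groups of variables (for bihomogeneous polynomials vanishing does not depend on the chosen
representatives; we require vanishing at every pair of representatives). -/
def Vbi {a b : ℕ} (h : MvPolynomial (Fin a ⊕ Fin b) ℂ) :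
    Set (Projectivization ℂ (Fin a → ℂ) × Projectivization ℂ (Fin b → ℂ)) :=
  { p | ∀ (w₁ : Fin a → ℂ) (h₁ : w₁ ≠ 0) (w₂ : Fin b → ℂ) (h₂ : w₂ ≠ 0),
      p = (Projectivization.mk ℂ w₁ h₁, Projectivization.mk ℂ w₂ h₂) →
        eval (Sum.elim w₁ w₂) h = 0 }

variable {m n : ℕ}
  (X : Set (Projectivization ℂ (Fin (m + 1) → ℂ) × Projectivization ℂ (Fin (n + 1) → ℂ)))

/-- The "open part" of the double cone: all points `([u : x], [v : y])` with `([x],[y]) ∈ X`. -/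
def dcT : Set (Projectivization ℂ (Fin (m + 2) → ℂ) × Projectivization ℂ (Fin (n + 2) → ℂ)) :=
  { q | ∃ (u v : ℂ) (x : Fin (m + 1) → ℂ) (y : Fin (n + 1) → ℂ) (hx : x ≠ 0) (hy : y ≠ 0),
      (Projectivization.mk ℂ x hx, Projectivization.mk ℂ y hy) ∈ X ∧
        q = (Projectivization.mk ℂ (Fin.cons u x) (cons_ne_zero u hx),
             Projectivization.mk ℂ (Fin.cons v y) (cons_ne_zero v hy)) }

/-- The part `{([u : x], [1 : 𝟎]) : [x] ∈ π_x(X)}` of the double cone. -/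
def dcA : Set (Projectivization ℂ (Fin (m + 2) → ℂ) × Projectivization ℂ (Fin (n + 2) → ℂ)) :=
  { q | ∃ (u : ℂ) (x : Fin (m + 1) → ℂ) (hx : x ≠ 0),
      Projectivization.mk ℂ x hx ∈ Prod.fst '' X ∧
        q = (Projectivization.mk ℂ (Fin.cons u x) (cons_ne_zero u hx), e0) }

/-- The part `{([1 : 𝟎], [v : y]) : [y] ∈ π_y(X)}` of the double cone. -/
def dcB : Set (Projectivization ℂ (Fin (m + 2) → ℂ) × Projectivization ℂ (Fin (n + 2) → ℂ)) :=
  { q | ∃ (v : ℂ) (y : Fin (n + 1) → ℂ) (hy : y ≠ 0),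
      Projectivization.mk ℂ y hy ∈ Prod.snd '' X ∧
        q = (e0, Projectivization.mk ℂ (Fin.cons v y) (cons_ne_zero v hy)) }

/-- The double cone `X̃ ⊆ ℙ^{m+1} × ℙ^{n+1}` of `X ⊆ ℙᵐ × ℙⁿ`. -/
def doubleCone :
    Set (Projectivization ℂ (Fin (m + 2) → ℂ) × Projectivization ℂ (Fin (n + 2) → ℂ)) :=
  dcT X ∪ dcA X ∪ dcB X ∪ {(e0, e0)}

end UGen

namespace UGen

lemma IsBihomogeneous.eval_smul {a b d e : ℕ} {g : MvPolynomial (Fin a ⊕ Fin b) ℂ}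
    (hg : IsBihomogeneous g d e) (s t : ℂ) (w₁ : Fin a → ℂ) (w₂ : Fin b → ℂ) :
    eval (Sum.elim (s • w₁) (t • w₂)) g = s ^ d * t ^ e * eval (Sum.elim w₁ w₂) g := by
  rw [eval_eq', eval_eq', Finset.mul_sum]
  refine Finset.sum_congr rfl fun k hk => ?_
  have hk' := hg (mem_support_iff.mp hk)
  rw [Finsupp.weight_apply, Finsupp.sum_fintype _ _ (by simp), Fintype.sum_sum_type] at hk'
  have h₁ : ∑ i, k (Sum.inl i) = d := by simpa [Prod.fst_sum] using congrArg Prod.fst hk'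
  have h₂ : ∑ i, k (Sum.inr i) = e := by simpa [Prod.snd_sum] using congrArg Prod.snd hk'
  simp only [Fintype.prod_sum_type, Sum.elim_inl, Sum.elim_inr, Pi.smul_apply, smul_eq_mul,
    mul_pow, Finset.prod_mul_distrib, Finset.prod_pow_eq_pow_sum, h₁, h₂]
  ring

lemma isBihomogeneous_rename_inl {a b c : ℕ} {ℓ : MvPolynomial (Fin c) ℂ} {d : ℕ}
    (hℓ : ℓ.IsHomogeneous d) (f : Fin c → Fin a) :
    IsBihomogeneous (rename (Sum.inl ∘ f) ℓ : MvPolynomial (Fin a ⊕ Fin b) ℂ) d 0 := by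
  intro k hk
  obtain ⟨s, rfl, hs⟩ := coeff_rename_ne_zero _ _ _ hk
  have h := hℓ hs
  rw [Finsupp.weight_apply, Finsupp.sum_fintype _ _ (by simp)] at h
  rw [Finsupp.weight_apply, Finsupp.sum_mapDomain_index (by simp) (by simp [add_smul]),
    Finsupp.sum_fintype _ _ (by simp)]
  ext <;> simp [Prod.fst_sum, Prod.snd_sum, ← h]

lemma isBihomogeneous_rename_inr {a b c : ℕ} {ℓ : MvPolynomial (Fin c) ℂ} {d : ℕ}
    (hℓ : ℓ.IsHomogeneous d) (f : Fin c → Fin b) :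
    IsBihomogeneous (rename (Sum.inr ∘ f) ℓ : MvPolynomial (Fin a ⊕ Fin b) ℂ) 0 d := by
  intro k hk
  obtain ⟨s, rfl, hs⟩ := coeff_rename_ne_zero _ _ _ hk
  have h := hℓ hs
  rw [Finsupp.weight_apply, Finsupp.sum_fintype _ _ (by simp)] at h
  rw [Finsupp.weight_apply, Finsupp.sum_mapDomain_index (by simp) (by simp [add_smul]),
    Finsupp.sum_fintype _ _ (by simp)]
  ext <;> simp [Prod.fst_sum, Prod.snd_sum, ← h]

lemma IsBihomogeneous.mk_mem_Vbi_iff {a b d e : ℕ} {g : MvPolynomial (Fin a ⊕ Fin b) ℂ}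
    (hg : IsBihomogeneous g d e) {w₁ : Fin a → ℂ} (h₁ : w₁ ≠ 0) {w₂ : Fin b → ℂ} (h₂ : w₂ ≠ 0) :
    (Projectivization.mk ℂ w₁ h₁, Projectivization.mk ℂ w₂ h₂) ∈ Vbi g ↔
      eval (Sum.elim w₁ w₂) g = 0 := by
  refine ⟨fun h => h w₁ h₁ w₂ h₂ rfl, fun h v₁ hv₁ v₂ hv₂ hv => ?_⟩
  obtain ⟨hp, hq⟩ := Prod.mk.inj hv
  obtain ⟨s, rfl⟩ := (Projectivization.mk_eq_mk_iff' ℂ _ _ hv₁ h₁).mp hp.symm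
  obtain ⟨t, rfl⟩ := (Projectivization.mk_eq_mk_iff' ℂ _ _ hv₂ h₂).mp hq.symm
  rw [hg.eval_smul, h, mul_zero]

lemma smul_cons_eq_cons_iff {N : ℕ} {u v c : ℂ} {x y : Fin N → ℂ} :
    (c • (Fin.cons v y : Fin (N + 1) → ℂ)) = Fin.cons u x ↔ c * v = u ∧ c • y = x := by
  simp [funext_iff, Fin.forall_fin_succ]

lemma eval_zero_of_isHomogeneous {N d : ℕ} (hd : d ≠ 0) {ℓ : MvPolynomial (Fin N) ℂ}
    (hℓ : ℓ.IsHomogeneous d) : eval 0 ℓ = 0 := by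
  rw [eval_zero, constantCoeff_eq]
  exact hℓ.coeff_eq_zero (by simpa using hd.symm)

lemma mk_cons_ne_e0 {N : ℕ} (u : ℂ) {x : Fin N → ℂ} (hx : x ≠ 0) :
    Projectivization.mk ℂ (Fin.cons u x) (cons_ne_zero u hx) ≠ e0 := by
  intro h
  obtain ⟨c, hc⟩ := (Projectivization.mk_eq_mk_iff' ℂ _ _ _ _).mp h
  obtain ⟨-, h⟩ := smul_cons_eq_cons_iff.mp hc
  exact hx (by simpa using h.symm)

/-- The points of the open cone over `S` at which `F` vanishes. -/
def coneZeros {N : ℕ} (S : Set (Projectivization ℂ (Fin (N + 1) → ℂ)))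
    (F : (Fin (N + 2) → ℂ) → ℂ) : Set (Projectivization ℂ (Fin (N + 2) → ℂ)) :=
  { q | ∃ (u : ℂ) (x : Fin (N + 1) → ℂ) (hx : x ≠ 0),
      Projectivization.mk ℂ x hx ∈ S ∧ F (Fin.cons u x) = 0 ∧
        q = Projectivization.mk ℂ (Fin.cons u x) (cons_ne_zero u hx) }

lemma coneZeros_finite_and_ncard {N d : ℕ} (hd : 1 ≤ d)
    {S : Set (Projectivization ℂ (Fin (N + 1) → ℂ))} (hS : S.Finite)
    {F : (Fin (N + 2) → ℂ) → ℂ} (hF : ∀ (c : ℂ) w, F w = 0 → F (c • w) = 0)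
    (hroots : ∀ (x : Fin (N + 1) → ℂ) (hx : x ≠ 0), Projectivization.mk ℂ x hx ∈ S →
      {u : ℂ | F (Fin.cons u x) = 0}.ncard = d) :
    (coneZeros S F).Finite ∧ (coneZeros S F).ncard = d * S.ncard := by
  classical
  have hR : ∀ p : Projectivization ℂ (Fin (N + 1) → ℂ), ∃ R : Finset ℂ,
      p ∈ S → R.card = d ∧ ∀ u, u ∈ R ↔ F (Fin.cons u p.rep) = 0 := by
    intro p
    by_cases hp : p ∈ S
    · have hcard := hroots p.rep p.rep_nonzero (by rwa [p.mk_rep])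
      have hfin := Set.finite_of_ncard_pos (by omega :
        0 < {u : ℂ | F (Fin.cons u p.rep) = 0}.ncard)
      exact ⟨hfin.toFinset, fun _ => ⟨by rw [← Set.ncard_eq_toFinset_card _ hfin, hcard],
        fun u => by simp⟩⟩
    · exact ⟨∅, fun h => absurd h hp⟩
  choose R hR using hR
  let f : (Σ _ : Projectivization ℂ (Fin (N + 1) → ℂ), ℂ) →
      Projectivization ℂ (Fin (N + 2) → ℂ) := fun p =>
    Projectivization.mk ℂ (Fin.cons p.2 p.1.rep) (cons_ne_zero p.2 p.1.rep_nonzero)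
  have hf : Function.Injective f := by
    rintro ⟨p, u⟩ ⟨q, v⟩ h
    obtain ⟨c, hc⟩ := (Projectivization.mk_eq_mk_iff' ℂ _ _ _ _).mp h
    obtain ⟨hu, hp⟩ := smul_cons_eq_cons_iff.mp hc
    obtain rfl : p = q := by
      rw [← p.mk_rep, ← q.mk_rep]
      exact (Projectivization.mk_eq_mk_iff' ℂ _ _ _ _).mpr ⟨c, hp⟩
    obtain rfl : c = 1 := smul_left_injective ℂ p.rep_nonzero (by simpa using hp)
    simpa using hu.symm
  have hset : coneZeros S F = (hS.toFinset.sigma R).image f := by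
    ext q
    simp only [Finset.coe_image, Set.mem_image, Finset.mem_coe, Finset.mem_sigma,
      Set.Finite.mem_toFinset]
    constructor
    · rintro ⟨u, x, hx, hxS, hu, rfl⟩
      obtain ⟨c, hc⟩ := Projectivization.exists_smul_eq_mk_rep ℂ x hx
      have hcons : (c : ℂ) • (Fin.cons u x : Fin (N + 2) → ℂ) =
          Fin.cons (c * u) (Projectivization.mk ℂ x hx).rep :=
        smul_cons_eq_cons_iff.mpr ⟨rfl, hc⟩
      refine ⟨⟨Projectivization.mk ℂ x hx, c * u⟩, ⟨hxS, ((hR _ hxS).2 _).mpr ?_⟩, ?_⟩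
      · rw [← hcons]
        exact hF _ _ hu
      · exact (Projectivization.mk_eq_mk_iff' ℂ _ _ _ _).mpr ⟨c, hcons⟩
    · rintro ⟨⟨p, u⟩, ⟨hp, hu⟩, rfl⟩
      exact ⟨u, p.rep, p.rep_nonzero, by rwa [p.mk_rep], ((hR p hp).2 u).mp hu, rfl⟩
  rw [hset]
  refine ⟨Finset.finite_toSet _, ?_⟩
  rw [Set.ncard_coe_finset, Finset.card_image_of_injective _ hf, Finset.card_sigma,
    Finset.sum_congr rfl fun p hp => (hR p (hS.mem_toFinset.mp hp)).1, Finset.sum_const,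
    smul_eq_mul, mul_comm, ← Set.ncard_eq_toFinset_card _ hS]

end UGen

/-- Under the stated genericity hypotheses, `X̃ ∩ V(g₀, ℓ_x, ℓ_y)` is a
finite set of cardinality `d · |W_x| + e · |W_y|`, where `W_x = X ∩ V(ℓ_x)` and
`W_y = X ∩ V(ℓ_y)`. -/
theorem statement13 {m n d e : ℕ}
    (X : Set (Projectivization ℂ (Fin (m + 1) → ℂ) × Projectivization ℂ (Fin (n + 1) → ℂ)))
    (hXcl : IsClosed X)
    (ℓx : MvPolynomial (Fin (m + 1)) ℂ) (hℓx : ℓx.IsHomogeneous 1)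
    (ℓy : MvPolynomial (Fin (n + 1)) ℂ) (hℓy : ℓy.IsHomogeneous 1)
    (g0 : MvPolynomial (Fin (m + 2) ⊕ Fin (n + 2)) ℂ)
    (hg0 : UGen.IsBihomogeneous g0 d e) (hd : 1 ≤ d) (he : 1 ≤ e)
    (hWxfin : (X ∩ UGen.Vbi (rename Sum.inl ℓx)).Finite)
    (hWyfin : (X ∩ UGen.Vbi (rename Sum.inr ℓy)).Finite)
    (hslice : X ∩ UGen.Vbi (rename Sum.inl ℓx) ∩ UGen.Vbi (rename Sum.inr ℓy) = ∅)
    (hg0e : eval (Sum.elim (Fin.cons 1 0) (Fin.cons 1 0)) g0 ≠ 0)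
    (hinjx : Set.InjOn Prod.fst (X ∩ UGen.Vbi (rename Sum.inl ℓx)))
    (hinjy : Set.InjOn Prod.snd (X ∩ UGen.Vbi (rename Sum.inr ℓy)))
    (hrootsx : ∀ p ∈ X ∩ UGen.Vbi (rename Sum.inl ℓx),
      ∀ (x : Fin (m + 1) → ℂ) (hx : x ≠ 0), p.1 = Projectivization.mk ℂ x hx →
        {u : ℂ | eval (Sum.elim (Fin.cons u x) (Fin.cons 1 0)) g0 = 0}.ncard = d)
    (hrootsy : ∀ p ∈ X ∩ UGen.Vbi (rename Sum.inr ℓy),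
      ∀ (y : Fin (n + 1) → ℂ) (hy : y ≠ 0), p.2 = Projectivization.mk ℂ y hy →
        {v : ℂ | eval (Sum.elim (Fin.cons 1 0) (Fin.cons v y)) g0 = 0}.ncard = e) :
    (UGen.doubleCone X ∩ UGen.Vbi g0 ∩ UGen.Vbi (rename (Sum.inl ∘ Fin.succ) ℓx) ∩
        UGen.Vbi (rename (Sum.inr ∘ Fin.succ) ℓy)).Finite ∧
      (UGen.doubleCone X ∩ UGen.Vbi g0 ∩ UGen.Vbi (rename (Sum.inl ∘ Fin.succ) ℓx) ∩
          UGen.Vbi (rename (Sum.inr ∘ Fin.succ) ℓy)).ncard =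
        d * (X ∩ UGen.Vbi (rename Sum.inl ℓx)).ncard +
          e * (X ∩ UGen.Vbi (rename Sum.inr ℓy)).ncard := by
  have hx₀ : UGen.IsBihomogeneous (rename Sum.inl ℓx :
      MvPolynomial (Fin (m + 1) ⊕ Fin (n + 1)) ℂ) 1 0 :=
    UGen.isBihomogeneous_rename_inl hℓx id
  have hy₀ : UGen.IsBihomogeneous (rename Sum.inr ℓy :
      MvPolynomial (Fin (m + 1) ⊕ Fin (n + 1)) ℂ) 0 1 :=
    UGen.isBihomogeneous_rename_inr hℓy id
  have hx₁ : UGen.IsBihomogeneous (rename (Sum.inl ∘ Fin.succ) ℓx :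
      MvPolynomial (Fin (m + 2) ⊕ Fin (n + 2)) ℂ) 1 0 :=
    UGen.isBihomogeneous_rename_inl hℓx Fin.succ
  have hy₁ : UGen.IsBihomogeneous (rename (Sum.inr ∘ Fin.succ) ℓy :
      MvPolynomial (Fin (m + 2) ⊕ Fin (n + 2)) ℂ) 0 1 :=
    UGen.isBihomogeneous_rename_inr hℓy Fin.succ
  have hVx₀ {x : Fin (m + 1) → ℂ} (hx : x ≠ 0) {y : Fin (n + 1) → ℂ} (hy : y ≠ 0) :
      (Projectivization.mk ℂ x hx, Projectivization.mk ℂ y hy) ∈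
        UGen.Vbi (rename Sum.inl ℓx) ↔ eval x ℓx = 0 := by
    rw [hx₀.mk_mem_Vbi_iff, eval_rename, Sum.elim_comp_inl]
  have hVy₀ {x : Fin (m + 1) → ℂ} (hx : x ≠ 0) {y : Fin (n + 1) → ℂ} (hy : y ≠ 0) :
      (Projectivization.mk ℂ x hx, Projectivization.mk ℂ y hy) ∈
        UGen.Vbi (rename Sum.inr ℓy) ↔ eval y ℓy = 0 := by
    rw [hy₀.mk_mem_Vbi_iff, eval_rename, Sum.elim_comp_inr]
  have hVx₁ {u : ℂ} {x : Fin (m + 1) → ℂ} (hx : (Fin.cons u x : Fin (m + 2) → ℂ) ≠ 0)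
      {w : Fin (n + 2) → ℂ} (hw : w ≠ 0) :
      (Projectivization.mk ℂ (Fin.cons u x) hx, Projectivization.mk ℂ w hw) ∈
        UGen.Vbi (rename (Sum.inl ∘ Fin.succ) ℓx) ↔ eval x ℓx = 0 := by
    rw [hx₁.mk_mem_Vbi_iff, eval_rename, ← Function.comp_assoc, Sum.elim_comp_inl]
    rfl
  have hVy₁ {w : Fin (m + 2) → ℂ} (hw : w ≠ 0) {v : ℂ} {y : Fin (n + 1) → ℂ}
      (hy : (Fin.cons v y : Fin (n + 2) → ℂ) ≠ 0) :
      (Projectivization.mk ℂ w hw, Projectivization.mk ℂ (Fin.cons v y) hy) ∈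
        UGen.Vbi (rename (Sum.inr ∘ Fin.succ) ℓy) ↔ eval y ℓy = 0 := by
    rw [hy₁.mk_mem_Vbi_iff, eval_rename, ← Function.comp_assoc, Sum.elim_comp_inr]
    rfl
  have hℓx₀ : eval 0 ℓx = 0 := UGen.eval_zero_of_isHomogeneous one_ne_zero hℓx
  have hℓy₀ : eval 0 ℓy = 0 := UGen.eval_zero_of_isHomogeneous one_ne_zero hℓy
  set Wx := X ∩ UGen.Vbi (rename Sum.inl ℓx) with hWx
  set Wy := X ∩ UGen.Vbi (rename Sum.inr ℓy) with hWy
  let A := UGen.coneZeros (Prod.fst '' Wx)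
    fun w => eval (Sum.elim w (Fin.cons 1 0 : Fin (n + 2) → ℂ)) g0
  let B := UGen.coneZeros (Prod.snd '' Wy)
    fun w => eval (Sum.elim (Fin.cons 1 0 : Fin (m + 2) → ℂ) w) g0
  obtain ⟨hAfin, hAcard⟩ : A.Finite ∧ A.ncard = d * (Prod.fst '' Wx).ncard := by
    refine UGen.coneZeros_finite_and_ncard hd (hWxfin.image _) (fun c w h => ?_) ?_
    · simpa [h] using hg0.eval_smul c 1 w (Fin.cons 1 0)
    · rintro x hx ⟨p, hp, hpx⟩
      exact hrootsx p hp x hx hpx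
  obtain ⟨hBfin, hBcard⟩ : B.Finite ∧ B.ncard = e * (Prod.snd '' Wy).ncard := by
    refine UGen.coneZeros_finite_and_ncard he (hWyfin.image _) (fun c w h => ?_) ?_
    · simpa [h] using hg0.eval_smul 1 c (Fin.cons 1 0) w
    · rintro y hy ⟨p, hp, hpy⟩
      exact hrootsy p hp y hy hpy
  have hset : UGen.doubleCone X ∩ UGen.Vbi g0 ∩ UGen.Vbi (rename (Sum.inl ∘ Fin.succ) ℓx) ∩
      UGen.Vbi (rename (Sum.inr ∘ Fin.succ) ℓy) =
        (fun q => (q, UGen.e0)) '' A ∪ (fun q => (UGen.e0, q)) '' B := by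
    apply Set.Subset.antisymm
    · rintro q ⟨⟨⟨((hq | hq) | hq) | hq, hqg⟩, hqx⟩, hqy⟩
      · obtain ⟨u, v, x, y, hx, hy, hX, rfl⟩ := hq
        exact absurd ⟨⟨hX, (hVx₀ hx hy).mpr ((hVx₁ _ _).mp hqx)⟩,
          (hVy₀ hx hy).mpr ((hVy₁ _ _).mp hqy)⟩ (Set.eq_empty_iff_forall_notMem.mp hslice _)
      · obtain ⟨u, x, hx, ⟨⟨p, r⟩, hX, hp⟩, rfl⟩ := hq
        obtain rfl : p = _ := hp
        refine Or.inl ⟨_, ⟨u, x, hx, ⟨_, ⟨hX, ?_⟩, rfl⟩, (hg0.mk_mem_Vbi_iff _ _).mp hqg, rfl⟩,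
          rfl⟩
        rw [← r.mk_rep]
        exact (hVx₀ hx r.rep_nonzero).mpr ((hVx₁ _ _).mp hqx)
      · obtain ⟨v, y, hy, ⟨⟨r, p⟩, hX, hp⟩, rfl⟩ := hq
        obtain rfl : p = _ := hp
        refine Or.inr ⟨_, ⟨v, y, hy, ⟨_, ⟨hX, ?_⟩, rfl⟩, (hg0.mk_mem_Vbi_iff _ _).mp hqg, rfl⟩,
          rfl⟩
        rw [← r.mk_rep]
        exact (hVy₀ r.rep_nonzero hy).mpr ((hVy₁ _ _).mp hqy)
      · obtain rfl : q = _ := hq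
        exact absurd ((hg0.mk_mem_Vbi_iff _ _).mp hqg) hg0e
    · rintro _ (⟨_, ⟨u, x, hx, ⟨⟨p, r⟩, ⟨hX, hV⟩, hp⟩, hu, rfl⟩, rfl⟩ |
        ⟨_, ⟨v, y, hy, ⟨⟨r, p⟩, ⟨hX, hV⟩, hp⟩, hv, rfl⟩, rfl⟩)
      · obtain rfl : p = _ := hp
        refine ⟨⟨⟨Or.inl (Or.inl (Or.inr ⟨u, x, hx, ⟨_, hX, rfl⟩, rfl⟩)),
          (hg0.mk_mem_Vbi_iff _ _).mpr hu⟩, (hVx₁ _ _).mpr ?_⟩, (hVy₁ _ _).mpr hℓy₀⟩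
        rw [← r.mk_rep] at hV
        exact (hVx₀ hx r.rep_nonzero).mp hV
      · obtain rfl : p = _ := hp
        refine ⟨⟨⟨Or.inl (Or.inr ⟨v, y, hy, ⟨_, hX, rfl⟩, rfl⟩),
          (hg0.mk_mem_Vbi_iff _ _).mpr hv⟩, (hVx₁ _ _).mpr hℓx₀⟩, (hVy₁ _ _).mpr ?_⟩
        rw [← r.mk_rep] at hV
        exact (hVy₀ r.rep_nonzero hy).mp hV
  have hdisj : Disjoint ((fun q => (q, (UGen.e0 : Projectivization ℂ (Fin (n + 2) → ℂ)))) '' A)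
      ((fun q => (UGen.e0, q)) '' B) := by
    rw [Set.disjoint_left]
    rintro _ ⟨_, ⟨u, x, hx, -, -, rfl⟩, rfl⟩ ⟨_, -, h⟩
    exact UGen.mk_cons_ne_e0 u hx (congrArg Prod.fst h).symm
  rw [hset]
  refine ⟨(hAfin.image _).union (hBfin.image _), ?_⟩
  rw [Set.ncard_union_eq hdisj (hAfin.image _) (hBfin.image _),
    Set.ncard_image_of_injective _ (Prod.mk_left_injective _),
    Set.ncard_image_of_injective _ (Prod.mk_right_injective _), hAcard, hBcard,
    hinjx.ncard_image, hinjy.ncard_image]
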